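/- arXiv:2307.11935 — 8 statements merged into one kernel-verified Lean document; each statement's English description precedes it below -/
import Mathlib

section
/- Let α ∈ (0,2] and define Q_α : (0,1) → (0,∞) by Q_α(x) = x/(1−x)^{2/α−1} (real powers). Let Q_{t,α} be the differentiation flow started from Q_α, i.e. Q_{t,α}(x) = x(1−t)·Q_α((1−t)x+t)/(x(1−t)+t). Then for all x, t ∈ (0,1), Q_{t,α}(x) = (1−t)^{2−2/α} · Q_α(x). In other words, the measure with radial quantile function Q_α is stable under the differentiation flow: it evolves only by the dilation factor (1−t)^{2−2/α}. -/
/- STATEMENT 4: For α ∈ (0,2] and Q_α(x) = x/(1−x)^{2/α−1} (real powers), the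
differentiation flow started from Q_α satisfies Q_{t,α}(x) = (1−t)^{2−2/α}·Q_α(x)
for all x, t ∈ (0,1): the measure with radial quantile Q_α is differentiation stable. -/
theorem stmt4 (α : ℝ) (hα : α ∈ Set.Ioc (0 : ℝ) 2) (x t : ℝ)
    (hx : x ∈ Set.Ioo (0 : ℝ) 1) (ht : t ∈ Set.Ioo (0 : ℝ) 1) :
    x * (1 - t) *
        ((fun y => y / (1 - y) ^ (2 / α - 1)) ((1 - t) * x + t)) / (x * (1 - t) + t)
      = (1 - t) ^ (2 - 2 / α) * ((fun y => y / (1 - y) ^ (2 / α - 1)) x) := by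
  obtain ⟨hx0, hx1⟩ := hx
  obtain ⟨ht0, ht1⟩ := ht
  have hs : 0 < 1 - t := sub_pos.2 ht1
  have hy : 0 < 1 - x := sub_pos.2 hx1
  have hd : x * (1 - t) + t ≠ 0 := by positivity
  have hsp : (1 - t) ^ (2 / α - 1) ≠ 0 := (Real.rpow_pos_of_pos hs _).ne'
  have hyp : (1 - x) ^ (2 / α - 1) ≠ 0 := (Real.rpow_pos_of_pos hy _).ne'
  have hfactor : 1 - ((1 - t) * x + t) = (1 - t) * (1 - x) := by ring
  have hexp : (1 - t) ^ (2 - 2 / α) = (1 - t) / (1 - t) ^ (2 / α - 1) := by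
    rw [show 2 - 2 / α = 1 - (2 / α - 1) by ring, Real.rpow_sub hs, Real.rpow_one]
  beta_reduce
  rw [hfactor, Real.mul_rpow hs.le hy.le, hexp, mul_comm (1 - t) x]
  generalize (1 - t) ^ (2 / α - 1) = a at *
  generalize (1 - x) ^ (2 / α - 1) = b at *
  field_simp
end

section
/- Let α ∈ (0,2] and let S : (−1,0) → (0,∞). Then the following are equivalent: (i) there exists θ > 0 such that S(z) = θ·(−z)^{2/α−1}/(1+z) for all z ∈ (−1,0); (ii) for all λ ∈ (0,1] and all z ∈ (−1,0), S(z) = λ^{1−2/α} · ((1+λz)/(1+z)) · S(λz). (This is the characterization, due to Kösters–Tikhomirov and reproved in this paper, of the S-transforms S = S_{aa*} of α-⊕-stable Brown measures of R-diagonal elements: condition (ii) expresses that the Brown measure of a is invariant under the map a ↦ λ^{1/α−1} π_λ(a), i.e. under forming (a₁+⋯+a_k)/k^{1/α}.) -/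
/- STATEMENT 5: For α ∈ (0,2] and S : (−1,0) → (0,∞), the following are equivalent:
(i) ∃ θ > 0 with S(z) = θ·(−z)^{2/α−1}/(1+z) on (−1,0);
(ii) ∀ λ ∈ (0,1], ∀ z ∈ (−1,0), S(z) = λ^{1−2/α}·((1+λz)/(1+z))·S(λz).
(Characterization of S-transforms of α-⊕-stable Brown measures of R-diagonal elements.) -/
theorem stmt5 (α : ℝ) (hα : α ∈ Set.Ioc (0 : ℝ) 2) (S : ℝ → ℝ)
    (hS : ∀ z ∈ Set.Ioo (-1 : ℝ) 0, 0 < S z) :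
    (∃ θ : ℝ, 0 < θ ∧ ∀ z ∈ Set.Ioo (-1 : ℝ) 0,
        S z = θ * (-z) ^ (2 / α - 1) / (1 + z)) ↔
    (∀ lam ∈ Set.Ioc (0 : ℝ) 1, ∀ z ∈ Set.Ioo (-1 : ℝ) 0,
        S z = lam ^ (1 - 2 / α) * ((1 + lam * z) / (1 + z)) * S (lam * z)) := by
  set p := 2 / α - 1 with hp
  have hneg : 1 - 2 / α = -p := by rw [hp]; ring
  rw [hneg]
  constructor
  · rintro ⟨θ, -, h⟩ l ⟨hl0, hl1⟩ z hz
    have hlz : l * z ∈ Set.Ioo (-1 : ℝ) 0 :=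
      ⟨by nlinarith [hz.1, hz.2], mul_neg_of_pos_of_neg hl0 hz.2⟩
    have h1 : 1 + z ≠ 0 := by linarith [hz.1]
    have h2 : 1 + l * z ≠ 0 := by linarith [hlz.1]
    have hlp : l ^ p ≠ 0 := (Real.rpow_pos_of_pos hl0 p).ne'
    rw [h z hz, h _ hlz, ← mul_neg, Real.mul_rpow hl0.le (by linarith [hz.2]),
      Real.rpow_neg hl0.le]
    generalize 1 + l * z = w at h2 ⊢
    field_simp
  · intro h
    have hhalf : (-(1 / 2) : ℝ) ∈ Set.Ioo (-1 : ℝ) 0 := by norm_num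
    refine ⟨S (-(1 / 2)) / 2 * 2 ^ p,
      mul_pos (half_pos (hS _ hhalf)) (Real.rpow_pos_of_pos two_pos p), fun z hz => ?_⟩
    have h1 : 1 + z ≠ 0 := by linarith [hz.1]
    have hz0 : 0 < -z := by linarith [hz.2]
    have hzne : z ≠ 0 := hz.2.ne
    have ht : 0 < 2 * -z := by positivity
    have htp : (2 * -z) ^ p ≠ 0 := (Real.rpow_pos_of_pos ht p).ne'
    rw [eq_div_iff h1, mul_assoc, ← Real.mul_rpow two_pos.le hz0.le]
    rcases le_total (2 * -z) 1 with hle | hle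
    · have key := h (2 * -z) ⟨ht, hle⟩ _ hhalf
      rw [show 2 * -z * -(1 / 2) = z by ring, Real.rpow_neg ht.le] at key
      rw [key]
      generalize (2 * -z) ^ p = c at htp ⊢
      field_simp
      ring
    · have key := h (2 * -z)⁻¹ ⟨inv_pos.2 ht, inv_le_one_of_one_le₀ hle⟩ z hz
      rw [show (2 * -z)⁻¹ * z = -(1 / 2) by field_simp, Real.rpow_neg (inv_pos.2 ht).le,
        Real.inv_rpow ht.le, inv_inv] at key
      rw [key]
      generalize (2 * -z) ^ p = c at htp ⊢
      field_simp
      ring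
end

section
/- Let α ∈ (0,2), let Q₀ : (0,1) → (0,∞) be nondecreasing, and let f : (0,1) → (0,∞) satisfy: (a) f(x)·(1−x)^{2/α−1}·Q₀(x) → 1 as x → 1⁻, and (b) for every x ∈ (0,1), f(t)/f((1−t)x+t) → 1 as t → 1⁻. For t ∈ (0,1) let Q_t(x) = x(1−t)·Q₀((1−t)x+t)/(x(1−t)+t) be the differentiation flow. Then for every x ∈ (0,1), lim_{t→1⁻} f(t)·(1−t)^{2/α−2}·Q_t(x) = x/(1−x)^{2/α−1}. (This is the core quantile-level computation in the proof of the central-limit-type theorem for repeated differentiation.) -/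
/- STATEMENT 6: Let α ∈ (0,2), Q₀ : (0,1) → (0,∞) nondecreasing, f : (0,1) → (0,∞) with
(a) f(x)·(1−x)^{2/α−1}·Q₀(x) → 1 as x → 1⁻, and (b) f(t)/f((1−t)x+t) → 1 as t → 1⁻
for every x ∈ (0,1). Then for every x ∈ (0,1),
lim_{t→1⁻} f(t)·(1−t)^{2/α−2}·Q_t(x) = x/(1−x)^{2/α−1}, where Q_t is the
differentiation flow started from Q₀. -/
theorem stmt6 (α : ℝ) (hα : α ∈ Set.Ioo (0 : ℝ) 2) (Q₀ f : ℝ → ℝ)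
    (hQpos : ∀ x ∈ Set.Ioo (0 : ℝ) 1, 0 < Q₀ x)
    (hQmono : MonotoneOn Q₀ (Set.Ioo (0 : ℝ) 1))
    (hfpos : ∀ x ∈ Set.Ioo (0 : ℝ) 1, 0 < f x)
    (ha : Filter.Tendsto (fun x => f x * (1 - x) ^ (2 / α - 1) * Q₀ x)
      (nhdsWithin 1 (Set.Iio 1)) (nhds 1))
    (hb : ∀ x ∈ Set.Ioo (0 : ℝ) 1,
      Filter.Tendsto (fun t => f t / f ((1 - t) * x + t))
        (nhdsWithin 1 (Set.Iio 1)) (nhds 1)) :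
    ∀ x ∈ Set.Ioo (0 : ℝ) 1,
      Filter.Tendsto
        (fun t => f t * (1 - t) ^ (2 / α - 2) *
          (x * (1 - t) * Q₀ ((1 - t) * x + t) / (x * (1 - t) + t)))
        (nhdsWithin 1 (Set.Iio 1)) (nhds (x / (1 - x) ^ (2 / α - 1))) := by
  intro x hx
  have hy : Filter.Tendsto (fun t : ℝ => (1 - t) * x + t) (nhdsWithin 1 (Set.Iio 1)) (nhds 1) := by
    have h : Continuous fun t : ℝ => (1 - t) * x + t := by fun_prop
    simpa using (h.tendsto 1).mono_left nhdsWithin_le_nhds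
  have hy' : Filter.Tendsto (fun t : ℝ => (1 - t) * x + t) (nhdsWithin 1 (Set.Iio 1))
      (nhdsWithin 1 (Set.Iio 1)) := by
    refine tendsto_nhdsWithin_iff.2 ⟨hy, ?_⟩
    filter_upwards [self_mem_nhdsWithin] with t ht
    have ht' : t < 1 := ht
    change (1 - t) * x + t < 1
    nlinarith [hx.2]
  have hlim := ((hb x hx).mul (ha.comp hy')).mul
    ((tendsto_const_nhds (x := x / (1 - x) ^ (2 / α - 1))).div hy one_ne_zero)
  simp only [one_mul, div_one] at hlim
  refine hlim.congr' ?_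
  filter_upwards [Ioo_mem_nhdsLT zero_lt_one] with t ht
  have h1t : 0 < 1 - t := sub_pos.2 ht.2
  have h1x : 0 < 1 - x := sub_pos.2 hx.2
  have hy0 : 0 < (1 - t) * x + t := add_pos (mul_pos h1t hx.1) ht.1
  have hy1 : (1 - t) * x + t < 1 := by nlinarith
  have hf := (hfpos _ ⟨hy0, hy1⟩).ne'
  have hpow : (1 - ((1 - t) * x + t)) ^ (2 / α - 1)
      = (1 - t) ^ (2 / α - 2) * (1 - t) * (1 - x) ^ (2 / α - 1) := by
    rw [show 1 - ((1 - t) * x + t) = (1 - t) * (1 - x) by ring,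
      Real.mul_rpow h1t.le h1x.le, show 2 / α - 1 = 2 / α - 2 + 1 by ring,
      Real.rpow_add_one h1t.ne']
  have hxp := (Real.rpow_pos_of_pos h1x (2 / α - 1)).ne'
  simp only [Function.comp_apply, Pi.div_apply, hpow, mul_comm x (1 - t)]
  field_simp
end

section
/- Let α ∈ (0,2). Let Φ₀ : [0,∞) → [0,1] be nondecreasing and right-continuous with Φ₀(r) < 1 for all r (unbounded support), lim_{r→∞} Φ₀(r) = 1, and ∫₀¹ Φ₀(r) r^{−1} dr < ∞. Suppose there is a positive slowly varying function L (i.e. L : (0,∞) → (0,∞) with L(cx)/L(x) → 1 as x → ∞ for every c > 0) such that lim_{r→∞} (1−Φ₀(r)) / (L(r)·r^{−α/(2−α)}) = 1. Let Q₀ be the quantile function of Φ₀ and let Q_t be the differentiation flow started from Q₀. Then there exists a positive slowly varying function g : [1,∞) → (0,∞) such that for every x ∈ (0,1), lim_{t→1⁻} Q_t(x) / (g(1/(1−t)) · (1−t)^{2−2/α}) = x/(1−x)^{2/α−1}. Consequently the rescaled measures converge weakly to the α-differentiation stable law μ_α. -/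
open Filter MeasureTheory

/-- A function `L : (0,∞) → (0,∞)` is slowly varying if `L(cx)/L(x) → 1` as `x → ∞`
for every `c > 0`. -/
def SlowlyVarying (L : ℝ → ℝ) : Prop :=
  ∀ c : ℝ, 0 < c → Tendsto (fun x => L (c * x) / L x) atTop (nhds 1)

/-- The generalized inverse `s ↦ inf {r ≥ 0 : F r ≤ 1 / s}` of a tail function `F`. -/
noncomputable def tailQuantile (F : ℝ → ℝ) (s : ℝ) : ℝ :=
  sInf {r : ℝ | 0 ≤ r ∧ F r ≤ 1 / s}

theorem tailQuantile_le {F : ℝ → ℝ} {r s : ℝ} (hr : 0 ≤ r) (h : F r ≤ 1 / s) :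
    tailQuantile F s ≤ r :=
  csInf_le ⟨0, fun _ hy => hy.1⟩ ⟨hr, h⟩

theorem le_of_tailQuantile_lt {F : ℝ → ℝ} (hF : AntitoneOn F (Set.Ici 0))
    (hF0 : Tendsto F atTop (nhds 0)) {r s : ℝ} (hs : 0 < s) (h : tailQuantile F s < r) :
    F r ≤ 1 / s := by
  have hne : {r : ℝ | 0 ≤ r ∧ F r ≤ 1 / s}.Nonempty :=
    ((eventually_ge_atTop (0 : ℝ)).and
      (hF0.eventually (eventually_le_nhds (one_div_pos.2 hs)))).exists
  obtain ⟨y, hy, hyr⟩ := exists_lt_of_csInf_lt hne h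
  exact (hF hy.1 (hy.1.trans hyr.le) hyr.le).trans hy.2

theorem tendsto_tailQuantile_atTop {F : ℝ → ℝ} (hF : AntitoneOn F (Set.Ici 0))
    (hpos : ∀ r, 0 ≤ r → 0 < F r) (hF0 : Tendsto F atTop (nhds 0)) :
    Tendsto (tailQuantile F) atTop atTop := by
  rw [tendsto_atTop]
  intro R
  have hR : (0 : ℝ) ≤ max R 0 := le_max_right _ _
  filter_upwards [eventually_gt_atTop (1 / F (max R 0)), eventually_gt_atTop 0] with s hs hs0
  by_contra! hlt
  have h := le_of_tailQuantile_lt hF hF0 hs0 (hlt.trans_le (le_max_left R 0))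
  rw [div_lt_iff₀ (hpos _ hR)] at hs
  rw [le_div_iff₀ hs0] at h
  linarith

/-- If `F` is regularly varying of index `-ρ`, its generalized inverse is eventually bounded as a
regularly varying function of index `κ = 1 / ρ` should be. -/
theorem eventually_tailQuantile_mul_le {F : ℝ → ℝ} {ρ κ : ℝ} (hF : AntitoneOn F (Set.Ici 0))
    (hpos : ∀ r, 0 ≤ r → 0 < F r) (hF0 : Tendsto F atTop (nhds 0)) (hρ : 0 < ρ)
    (hρκ : κ * ρ = 1)
    (hrv : ∀ c : ℝ, 0 < c → Tendsto (fun r => F (c * r) / F r) atTop (nhds (c ^ (-ρ))))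
    {c l : ℝ} (hc : 0 < c) (hl : c ^ κ < l) :
    ∀ᶠ s in atTop, tailQuantile F (c * s) ≤ l * tailQuantile F s := by
  have hcκ : 0 < c ^ κ := Real.rpow_pos_of_pos hc κ
  obtain ⟨m, hcm, hml⟩ := exists_between hl
  have hm : 0 < m := hcκ.trans hcm
  have hδ : 1 < l / m := (one_lt_div hm).2 hml
  have hcρ : m ^ (-ρ) < 1 / c := by
    have h := Real.rpow_lt_rpow hcκ.le hcm hρ
    rw [← Real.rpow_mul hc.le, hρκ, Real.rpow_one] at h
    rw [Real.rpow_neg hm.le, ← one_div]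
    exact one_div_lt_one_div_of_lt hc h
  have hq := tendsto_tailQuantile_atTop hF hpos hF0
  have hδq : Tendsto (fun s => l / m * tailQuantile F s) atTop atTop :=
    hq.const_mul_atTop (zero_lt_one.trans hδ)
  filter_upwards [hδq.eventually ((hrv m hm).eventually (eventually_lt_nhds hcρ)),
    hq.eventually_gt_atTop 0, eventually_gt_atTop 0] with s hs hqs hs0
  have hδqs : tailQuantile F s < l / m * tailQuantile F s := lt_mul_left hqs hδ
  have hFδ := le_of_tailQuantile_lt hF hF0 hs0 hδqs
  rw [div_lt_iff₀ (hpos _ (hqs.trans hδqs).le), ← mul_assoc, mul_div_cancel₀ _ hm.ne'] at hs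
  refine tailQuantile_le (mul_nonneg (hcκ.trans hl).le hqs.le) (hs.le.trans ?_)
  calc 1 / c * F (l / m * tailQuantile F s) ≤ 1 / c * (1 / s) := by gcongr
    _ = 1 / (c * s) := by rw [one_div_mul_one_div]

/-- The generalized inverse of a tail that is regularly varying of index `-ρ` is regularly varying
of index `κ = 1 / ρ`. -/
theorem tendsto_tailQuantile_div {F : ℝ → ℝ} {ρ κ : ℝ} (hF : AntitoneOn F (Set.Ici 0))
    (hpos : ∀ r, 0 ≤ r → 0 < F r) (hF0 : Tendsto F atTop (nhds 0)) (hρ : 0 < ρ)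
    (hρκ : κ * ρ = 1)
    (hrv : ∀ c : ℝ, 0 < c → Tendsto (fun r => F (c * r) / F r) atTop (nhds (c ^ (-ρ))))
    {c : ℝ} (hc : 0 < c) :
    Tendsto (fun s => tailQuantile F (c * s) / tailQuantile F s) atTop (nhds (c ^ κ)) := by
  have hcκ : 0 < c ^ κ := Real.rpow_pos_of_pos hc κ
  have hq := tendsto_tailQuantile_atTop hF hpos hF0
  have hcs : Tendsto (fun s : ℝ => c * s) atTop atTop := tendsto_id.const_mul_atTop hc
  rw [tendsto_order]
  constructor
  · intro a ha
    obtain ⟨b, hb, hbc⟩ := exists_between (max_lt ha hcκ)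
    have hb0 : 0 < b := (le_max_right a 0).trans_lt hb
    have hinv : (1 / c) ^ κ < 1 / b := by
      rw [Real.div_rpow zero_le_one hc.le, Real.one_rpow]
      exact one_div_lt_one_div_of_lt hb0 hbc
    have key := hcs.eventually
      (eventually_tailQuantile_mul_le hF hpos hF0 hρ hρκ hrv (one_div_pos.2 hc) hinv)
    filter_upwards [key, hq.eventually_gt_atTop 0] with s hs hqs
    rw [← mul_assoc, one_div_mul_cancel hc.ne', one_mul, one_div, inv_mul_eq_div,
      le_div_iff₀ hb0] at hs
    rw [lt_div_iff₀ hqs]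
    nlinarith [(le_max_left a 0).trans_lt hb]
  · intro a ha
    obtain ⟨b, hb, hba⟩ := exists_between ha
    filter_upwards [eventually_tailQuantile_mul_le hF hpos hF0 hρ hρκ hrv hc hb,
      hq.eventually_gt_atTop 0] with s hs hqs
    exact ((div_le_iff₀ hqs).2 hs).trans_lt hba

/-- A function asymptotic to `L r * r ^ (-ρ)` with `L` slowly varying is regularly varying. -/
theorem tendsto_div_of_slowlyVarying {F L : ℝ → ℝ} {ρ : ℝ} (hpos : ∀ r, 0 ≤ r → 0 < F r)
    (hLpos : ∀ x : ℝ, 0 < x → 0 < L x) (hL : SlowlyVarying L)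
    (htail : Tendsto (fun r => F r / (L r * r ^ (-ρ))) atTop (nhds 1)) {c : ℝ} (hc : 0 < c) :
    Tendsto (fun r => F (c * r) / F r) atTop (nhds (c ^ (-ρ))) := by
  have hcs : Tendsto (fun s : ℝ => c * s) atTop atTop := tendsto_id.const_mul_atTop hc
  have h := (((htail.comp hcs).mul (hL c hc)).div htail one_ne_zero).const_mul (c ^ (-ρ))
  rw [one_mul, div_one, mul_one] at h
  refine h.congr' ?_
  filter_upwards [eventually_gt_atTop 0] with r hr
  have h1 := (hLpos r hr).ne'
  have h2 := (hLpos (c * r) (mul_pos hc hr)).ne'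
  have h3 := (hpos r hr.le).ne'
  have h4 := (Real.rpow_pos_of_pos hr (-ρ)).ne'
  have h5 := (Real.rpow_pos_of_pos hc (-ρ)).ne'
  simp only [Function.comp_apply, Pi.div_apply]
  rw [Real.mul_rpow hc.le hr.le]
  field_simp

/- STATEMENT 7: Let α ∈ (0,2) and let Φ₀ : [0,∞) → [0,1] be nondecreasing,
right-continuous, with Φ₀(r) < 1 for all r, Φ₀(r) → 1 as r → ∞, and
∫₀¹ Φ₀(r) r^{−1} dr < ∞.  Suppose (1−Φ₀(r))/(L(r)·r^{−α/(2−α)}) → 1 as r → ∞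
for some positive slowly varying L.  Let Q₀(p) = inf{r ≥ 0 : Φ₀(r) ≥ p} be the quantile
function of Φ₀ and Q_t the differentiation flow started from Q₀.  Then there is a positive
slowly varying g : [1,∞) → (0,∞) such that for every x ∈ (0,1),
Q_t(x)/(g(1/(1−t))·(1−t)^{2−2/α}) → x/(1−x)^{2/α−1} as t → 1⁻. -/
theorem stmt7 (α : ℝ) (hα : α ∈ Set.Ioo (0 : ℝ) 2) (Φ₀ : ℝ → ℝ)
    (hmono : MonotoneOn Φ₀ (Set.Ici 0))
    (hrc : ∀ x : ℝ, 0 ≤ x → ContinuousWithinAt Φ₀ (Set.Ici x) x)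
    (hrange : ∀ r : ℝ, 0 ≤ r → Φ₀ r ∈ Set.Icc (0 : ℝ) 1)
    (hlt : ∀ r : ℝ, 0 ≤ r → Φ₀ r < 1)
    (hlim1 : Tendsto Φ₀ atTop (nhds 1))
    (hint : IntegrableOn (fun r => Φ₀ r / r) (Set.Ioo 0 1))
    (L : ℝ → ℝ) (hLpos : ∀ x : ℝ, 0 < x → 0 < L x) (hLsv : SlowlyVarying L)
    (htail : Tendsto (fun r => (1 - Φ₀ r) / (L r * r ^ (-(α / (2 - α)))))
      atTop (nhds 1)) :
    ∃ g : ℝ → ℝ, (∀ x : ℝ, 1 ≤ x → 0 < g x) ∧ SlowlyVarying g ∧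
      ∀ x ∈ Set.Ioo (0 : ℝ) 1,
        Tendsto
          (fun t =>
            (x * (1 - t) * sInf {r : ℝ | 0 ≤ r ∧ (1 - t) * x + t ≤ Φ₀ r} /
                (x * (1 - t) + t)) /
              (g (1 / (1 - t)) * (1 - t) ^ (2 - 2 / α)))
          (nhdsWithin 1 (Set.Iio 1)) (nhds (x / (1 - x) ^ (2 / α - 1))) := by
  obtain ⟨hα0, hα2⟩ := hα
  have h2α : 0 < 2 - α := by linarith
  set ρ := α / (2 - α) with hρdef
  set κ := 2 / α - 1 with hκdef
  have hρ : 0 < ρ := div_pos hα0 h2α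
  have hρκ : κ * ρ = 1 := by
    rw [hρdef, hκdef]
    field_simp
  set F : ℝ → ℝ := fun r => 1 - Φ₀ r with hFdef
  have hF : AntitoneOn F (Set.Ici 0) := fun a ha b hb hab => sub_le_sub_left (hmono ha hb hab) 1
  have hpos : ∀ r, 0 ≤ r → 0 < F r := fun r hr => sub_pos.2 (hlt r hr)
  have hF0 : Tendsto F atTop (nhds 0) := by simpa using hlim1.const_sub 1
  have hrv : ∀ c : ℝ, 0 < c → Tendsto (fun r => F (c * r) / F r) atTop (nhds (c ^ (-ρ))) :=
    fun c hc => tendsto_div_of_slowlyVarying hpos hLpos hLsv htail hc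
  have hq := tendsto_tailQuantile_atTop hF hpos hF0
  have hratio : ∀ c : ℝ, 0 < c →
      Tendsto (fun s => tailQuantile F (c * s) / tailQuantile F s) atTop (nhds (c ^ κ)) :=
    fun c hc => tendsto_tailQuantile_div hF hpos hF0 hρ hρκ hrv hc
  let g : ℝ → ℝ := fun s => if 0 < tailQuantile F s then tailQuantile F s * s ^ (-κ) else 1
  have hg : ∀ s, 0 < tailQuantile F s → g s = tailQuantile F s * s ^ (-κ) :=
    fun s hs => if_pos hs
  refine ⟨g, fun s hs => ?_, fun c hc => ?_, fun x hx => ?_⟩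
  · by_cases h : 0 < tailQuantile F s
    · rw [hg s h]
      exact mul_pos h (Real.rpow_pos_of_pos (zero_lt_one.trans_le hs) _)
    · simp [g, h]
  · have hcs : Tendsto (fun s : ℝ => c * s) atTop atTop := tendsto_id.const_mul_atTop hc
    have h := (hratio c hc).mul_const (c ^ (-κ))
    rw [← Real.rpow_add hc, add_neg_cancel, Real.rpow_zero] at h
    refine h.congr' ?_
    filter_upwards [eventually_gt_atTop 0, hq.eventually_gt_atTop 0,
      hcs.eventually (hq.eventually_gt_atTop 0)] with s hs hqs hqcs
    rw [hg _ hqs, hg _ hqcs, Real.mul_rpow hc.le hs.le]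
    have := (Real.rpow_pos_of_pos hs (-κ)).ne'
    field_simp
  · obtain ⟨hx0, hx1⟩ := hx
    have h1x : 0 < 1 - x := sub_pos.2 hx1
    have hs : Tendsto (fun t : ℝ => 1 / (1 - t)) (nhdsWithin 1 (Set.Iio 1)) atTop := by
      simp only [one_div]
      refine Tendsto.inv_tendsto_nhdsGT_zero (tendsto_nhdsWithin_iff.2 ⟨?_, ?_⟩)
      · have h : Tendsto (fun t : ℝ => 1 - t) (nhds 1) (nhds (1 - 1)) :=
          (continuous_const.sub continuous_id).tendsto 1
        rw [sub_self] at h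
        exact h.mono_left nhdsWithin_le_nhds
      · filter_upwards [self_mem_nhdsWithin] with t ht
        exact sub_pos.2 (Set.mem_Iio.1 ht)
    have hden : Tendsto (fun t : ℝ => x / (x * (1 - t) + t)) (nhdsWithin 1 (Set.Iio 1))
        (nhds x) := by
      have h : ContinuousAt (fun t : ℝ => x / (x * (1 - t) + t)) 1 :=
        ContinuousAt.div (by fun_prop) (by fun_prop) (by norm_num)
      have h' := h.tendsto
      norm_num at h'
      exact h'.mono_left nhdsWithin_le_nhds
    have h := hden.mul ((hratio (1 / (1 - x)) (one_div_pos.2 h1x)).comp hs)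
    rw [Real.div_rpow zero_le_one h1x.le, Real.one_rpow, mul_one_div] at h
    refine h.congr' ?_
    filter_upwards [self_mem_nhdsWithin, hs.eventually (hq.eventually_gt_atTop 0)] with t ht hqt
    have hu : 0 < 1 - t := sub_pos.2 ht
    have hset : sInf {r : ℝ | 0 ≤ r ∧ (1 - t) * x + t ≤ Φ₀ r} =
        tailQuantile F (1 / (1 - x) * (1 / (1 - t))) := by
      rw [tailQuantile, one_div_mul_one_div, one_div_one_div]
      congr 1
      ext r
      refine and_congr_right fun _ => ?_
      simp only [hFdef]
      constructor <;> intro h <;> linarith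
    have hpow : (1 / (1 - t)) ^ (-κ) * (1 - t) ^ (2 - 2 / α) = 1 - t := by
      rw [one_div, Real.inv_rpow hu.le, ← Real.rpow_neg hu.le, ← Real.rpow_add hu, hκdef]
      ring_nf
      exact Real.rpow_one _
    rw [hset, hg _ hqt, mul_assoc (tailQuantile F _), hpow, Function.comp_apply, div_mul_div_comm, div_div,
      mul_right_comm x (1 - t), ← mul_assoc,
      mul_div_mul_right _ _ hu.ne']
end

section
/- Let Φ₀ : [0,∞) → [0,1] be nondecreasing and right-continuous with ∫₀¹ Φ₀(r) r^{−1} dr < ∞ (so the associated rotationally invariant probability measure lies in RP_p(ℂ)) and inf{x ≥ 0 : Φ₀(x) = 1} = 1. Let Q₀ be the quantile function of Φ₀, let Q_t be the differentiation flow started from Q₀, and let Φ_t be the unique CDF whose quantile function is Q_t. Then for every fixed r ∈ (0,1), lim_{t→1⁻} Φ_t((1−t)r) = r. (That is, after rescaling by (1−t), the radial CDFs of the flow converge to the radial CDF r ↦ r of sq applied to the circular law.) -/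
open Filter MeasureTheory

/-- The Galois connection between a right-continuous distribution function and its quantiles. -/
lemma sInf_le_iff_le_of_monotone {F : ℝ → ℝ} (hF : Monotone F)
    (hrc : ∀ x : ℝ, ContinuousWithinAt F (Set.Ici x) x)
    (h0 : Tendsto F atBot (nhds 0)) (h1 : Tendsto F atTop (nhds 1))
    {p : ℝ} (hp : p ∈ Set.Ioo (0 : ℝ) 1) (x : ℝ) :
    sInf {x : ℝ | p ≤ F x} ≤ x ↔ p ≤ F x := by
  have hne : {x : ℝ | p ≤ F x}.Nonempty :=
    (h1.eventually_const_le hp.2).exists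
  have hbdd : BddBelow {x : ℝ | p ≤ F x} := by
    obtain ⟨b, hb⟩ := (h0.eventually_lt_const hp.1).exists
    exact ⟨b, fun y hy => (hF.reflect_lt (hb.trans_le hy)).le⟩
  refine ⟨fun h => ?_, fun h => csInf_le hbdd h⟩
  have hright : Tendsto F (nhdsWithin x (Set.Ioi x)) (nhds (F x)) :=
    (hrc x).mono_left (nhdsWithin_mono x Set.Ioi_subset_Ici_self)
  refine ge_of_tendsto hright ?_
  filter_upwards [self_mem_nhdsWithin] with y hy
  obtain ⟨z, hz, hzy⟩ := exists_lt_of_csInf_lt hne (h.trans_lt hy)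
  exact le_trans hz (hF hzy.le)

/-- A distribution function whose support has supremum `1` reaches the value `1` at `1`. -/
lemma apply_one_eq_one_of_sInf_eq_one {F : ℝ → ℝ} (hmono : MonotoneOn F (Set.Ici 0))
    (hrc : ∀ x : ℝ, 0 ≤ x → ContinuousWithinAt F (Set.Ici x) x)
    (hrange : ∀ r : ℝ, 0 ≤ r → F r ∈ Set.Icc (0 : ℝ) 1)
    (hsupp : sInf {x : ℝ | 0 ≤ x ∧ F x = 1} = 1) : F 1 = 1 := by
  have hne : {x : ℝ | 0 ≤ x ∧ F x = 1}.Nonempty := by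
    by_contra h
    rw [Set.not_nonempty_iff_eq_empty.mp h, Real.sInf_empty] at hsupp
    exact zero_ne_one hsupp
  refine le_antisymm (hrange 1 zero_le_one).2 ?_
  have hright : Tendsto F (nhdsWithin 1 (Set.Ioi 1)) (nhds (F 1)) :=
    (hrc 1 zero_le_one).mono_left (nhdsWithin_mono 1 Set.Ioi_subset_Ici_self)
  refine ge_of_tendsto hright ?_
  filter_upwards [self_mem_nhdsWithin] with y hy
  obtain ⟨z, hz, hzy⟩ := exists_lt_of_csInf_lt hne (hsupp.trans_lt hy)
  exact hz.2.symm.le.trans (hmono hz.1 (hz.1.trans hzy.le) hzy.le)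

/- STATEMENT 8: Let Φ₀ : [0,∞) → [0,1] be nondecreasing and right-continuous with
∫₀¹ Φ₀(r) r^{−1} dr < ∞ and inf{x ≥ 0 : Φ₀(x) = 1} = 1.  Let Q₀ be the quantile function
of Φ₀, Q_t the differentiation flow started from Q₀, and Φ_t the unique CDF whose quantile
function is Q_t.  Then for every fixed r ∈ (0,1), lim_{t→1⁻} Φ_t((1−t)r) = r. -/
theorem stmt8 (Φ₀ : ℝ → ℝ)
    (hmono : MonotoneOn Φ₀ (Set.Ici 0))
    (hrc : ∀ x : ℝ, 0 ≤ x → ContinuousWithinAt Φ₀ (Set.Ici x) x)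
    (hrange : ∀ r : ℝ, 0 ≤ r → Φ₀ r ∈ Set.Icc (0 : ℝ) 1)
    (hint : IntegrableOn (fun r => Φ₀ r / r) (Set.Ioo 0 1))
    (hsupp : sInf {x : ℝ | 0 ≤ x ∧ Φ₀ x = 1} = 1)
    (Q₀ : ℝ → ℝ)
    (hQ₀ : ∀ p ∈ Set.Ioo (0 : ℝ) 1, Q₀ p = sInf {x : ℝ | 0 ≤ x ∧ p ≤ Φ₀ x})
    (Qt : ℝ → ℝ → ℝ)
    (hQt : ∀ t ∈ Set.Ioo (0 : ℝ) 1, ∀ x ∈ Set.Ioo (0 : ℝ) 1,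
      Qt t x = x * (1 - t) * Q₀ ((1 - t) * x + t) / (x * (1 - t) + t))
    (Φt : ℝ → ℝ → ℝ)
    (hΦmono : ∀ t ∈ Set.Ioo (0 : ℝ) 1, Monotone (Φt t))
    (hΦrc : ∀ t ∈ Set.Ioo (0 : ℝ) 1, ∀ x : ℝ, ContinuousWithinAt (Φt t) (Set.Ici x) x)
    (hΦ0 : ∀ t ∈ Set.Ioo (0 : ℝ) 1, Tendsto (Φt t) atBot (nhds 0))
    (hΦ1 : ∀ t ∈ Set.Ioo (0 : ℝ) 1, Tendsto (Φt t) atTop (nhds 1))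
    (hΦq : ∀ t ∈ Set.Ioo (0 : ℝ) 1, ∀ p ∈ Set.Ioo (0 : ℝ) 1,
      sInf {x : ℝ | p ≤ Φt t x} = Qt t p) :
    ∀ r ∈ Set.Ioo (0 : ℝ) 1,
      Tendsto (fun t => Φt t ((1 - t) * r)) (nhdsWithin 1 (Set.Iio 1)) (nhds r) := by
  intro r hr
  have hΦ₀1 : Φ₀ 1 = 1 := apply_one_eq_one_of_sInf_eq_one hmono hrc hrange hsupp
  have hbdd : ∀ p : ℝ, BddBelow {x : ℝ | 0 ≤ x ∧ p ≤ Φ₀ x} := fun p => ⟨0, fun x hx => hx.1⟩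
  have hQ₀_le : ∀ p ∈ Set.Ioo (0 : ℝ) 1, Q₀ p ≤ 1 := fun p hp => by
    rw [hQ₀ p hp]
    exact csInf_le (hbdd p) ⟨zero_le_one, hp.2.le.trans_eq hΦ₀1.symm⟩
  have hle_Q₀ : ∀ y : ℝ, 0 ≤ y → ∀ p ∈ Set.Ioo (0 : ℝ) 1, Φ₀ y < p → y ≤ Q₀ p := by
    intro y hy p hp hyp
    rw [hQ₀ p hp]
    refine le_csInf ⟨1, zero_le_one, hp.2.le.trans_eq hΦ₀1.symm⟩ fun x hx => ?_
    by_contra! hxy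
    exact (hyp.trans_le hx.2).not_ge (hmono hx.1 hy hxy.le)
  have hlt_one : ∀ y : ℝ, 0 ≤ y → y < 1 → Φ₀ y < 1 := by
    intro y hy hy1
    refine (hrange y hy).2.lt_of_ne fun h => hy1.not_ge ?_
    rw [← hsupp]
    exact csInf_le ⟨0, fun x hx => hx.1⟩ ⟨hy, h⟩
  have hunit : ∀ᶠ t : ℝ in nhdsWithin 1 (Set.Iio 1), t ∈ Set.Ioo (0 : ℝ) 1 :=
    Ioo_mem_nhdsLT zero_lt_one
  have harg : ∀ t ∈ Set.Ioo (0 : ℝ) 1, ∀ p ∈ Set.Ioo (0 : ℝ) 1,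
      t < (1 - t) * p + t ∧ (1 - t) * p + t < 1 := by
    intro t ht p hp
    have h1t : 0 < 1 - t := sub_pos.mpr ht.2
    exact ⟨by nlinarith [mul_pos h1t hp.1], by nlinarith [hp.2]⟩
  rw [tendsto_order]
  constructor
  · intro a ha
    obtain ⟨p, hap, hpr⟩ := exists_between (max_lt ha hr.1)
    have hp : p ∈ Set.Ioo (0 : ℝ) 1 := ⟨(le_max_right _ _).trans_lt hap, hpr.trans hr.2⟩
    have hlim : Tendsto (fun t : ℝ => r * (p * (1 - t) + t)) (nhdsWithin 1 (Set.Iio 1))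
        (nhds r) := by
      have hc : Continuous fun t : ℝ => r * (p * (1 - t) + t) := by fun_prop
      simpa using (hc.tendsto 1).mono_left nhdsWithin_le_nhds
    filter_upwards [hunit, hlim.eventually_const_lt hpr] with t ht hpt
    refine ((le_max_left _ _).trans_lt hap).trans_le ?_
    rw [← sInf_le_iff_le_of_monotone (hΦmono t ht) (hΦrc t ht) (hΦ0 t ht) (hΦ1 t ht) hp,
      hΦq t ht p hp, hQt t ht p hp]
    have h1t : 0 < 1 - t := sub_pos.mpr ht.2
    obtain ⟨hargt, harg1⟩ := harg t ht p hp
    have hden : 0 < p * (1 - t) + t := by nlinarith [mul_pos h1t hp.1, ht.1]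
    rw [div_le_iff₀ hden]
    calc p * (1 - t) * Q₀ ((1 - t) * p + t) ≤ p * (1 - t) * 1 :=
          mul_le_mul_of_nonneg_left (hQ₀_le _ ⟨ht.1.trans hargt, harg1⟩)
            (mul_pos hp.1 h1t).le
      _ ≤ (1 - t) * r * (p * (1 - t) + t) := by nlinarith
  · intro a ha
    obtain ⟨p, hrp, hpa⟩ := exists_between (lt_min ha hr.2)
    have hp : p ∈ Set.Ioo (0 : ℝ) 1 := ⟨hr.1.trans hrp, hpa.trans_le (min_le_right _ _)⟩
    obtain ⟨y, hry, hy1⟩ := exists_between ((div_lt_one hp.1).mpr hrp)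
    have hy : 0 ≤ y := (div_pos hr.1 hp.1).le.trans hry.le
    rw [div_lt_iff₀ hp.1] at hry
    filter_upwards [hunit, Ioo_mem_nhdsLT (hlt_one y hy hy1)] with t ht hyt
    refine lt_trans ?_ (hpa.trans_le (min_le_left _ _))
    rw [← not_le, ← sInf_le_iff_le_of_monotone (hΦmono t ht) (hΦrc t ht) (hΦ0 t ht) (hΦ1 t ht) hp,
      hΦq t ht p hp, hQt t ht p hp, not_le]
    have h1t : 0 < 1 - t := sub_pos.mpr ht.2
    obtain ⟨hargt, harg1⟩ := harg t ht p hp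
    have hden : 0 < p * (1 - t) + t := by nlinarith [mul_pos h1t hp.1, ht.1]
    rw [lt_div_iff₀ hden]
    calc (1 - t) * r * (p * (1 - t) + t) ≤ (1 - t) * r * 1 :=
          mul_le_mul_of_nonneg_left (by linarith) (mul_pos h1t hr.1).le
      _ < p * (1 - t) * y := by nlinarith
      _ ≤ p * (1 - t) * Q₀ ((1 - t) * p + t) :=
          mul_le_mul_of_nonneg_left
            (hle_Q₀ y hy _ ⟨ht.1.trans hargt, harg1⟩ (hyt.1.trans hargt)) (mul_pos hp.1 h1t).le
end

section
/- Let β ≥ 0 and let (D_n) be a sequence of positive integers with D_n → ∞ and D_n/n → 0 as n → ∞. Set N_n = n − D_n and R_n = (n/D_n)^{1−β}. For 0 ≤ k ≤ D_n define the (deterministic parts of the) coefficients of the rescaled derivative polynomial P_n^{(N_n)}(z/R_n), namely T_{k,n} := binom(n, k+N_n)^β · ((k+N_n)! / k!) · R_n^{−k}. Define log P_β(x) := −x·log x − β(1−x)·log(1−x) + (1−β)x + β − 1 for x ∈ [0,1], with the convention 0·log 0 = 0. Then there exist constants c_n > 0 such that lim_{n→∞} sup_{0≤k≤D_n} | (1/D_n)·log(T_{k,n}/c_n)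 − log P_β(k/D_n) | = 0. -/
/-- The error in the leading-order Stirling approximation of `log j!`. -/
noncomputable def stirlingError (j : ℕ) : ℝ :=
  Real.log (j.factorial : ℝ) - (j * Real.log j - j)

theorem stirlingError_succ (j : ℕ) :
    stirlingError (j + 1) = stirlingError j + (1 - j * (Real.log (j + 1) - Real.log j)) := by
  unfold stirlingError
  rw [Nat.factorial_succ, Nat.cast_mul, Real.log_mul (by positivity) (by positivity)]
  push_cast
  ring

theorem mul_log_succ_sub_log_le_one (j : ℕ) :
    (j : ℝ) * (Real.log (j + 1) - Real.log j) ≤ 1 := by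
  rcases Nat.eq_zero_or_pos j with rfl | hj
  · simp
  have hj' : (0 : ℝ) < j := by exact_mod_cast hj
  have h := Real.log_le_sub_one_of_pos (show (0 : ℝ) < (j + 1) / j by positivity)
  rw [Real.log_div (by positivity) (by positivity)] at h
  calc (j : ℝ) * (Real.log (j + 1) - Real.log j) ≤ j * ((j + 1) / j - 1) := by gcongr
    _ = 1 := by field_simp; ring

theorem one_le_succ_mul_log_succ_sub_log {j : ℕ} (hj : 0 < j) :
    1 ≤ ((j : ℝ) + 1) * (Real.log (j + 1) - Real.log j) := by
  have hj' : (0 : ℝ) < j := by exact_mod_cast hj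
  have h := Real.log_le_sub_one_of_pos (show (0 : ℝ) < j / (j + 1) by positivity)
  rw [Real.log_div (by positivity) (by positivity)] at h
  have h2 : ((j : ℝ) + 1) * (Real.log j - Real.log (j + 1)) ≤ (j + 1) * (j / (j + 1) - 1) := by
    gcongr
  have h3 : ((j : ℝ) + 1) * (j / (j + 1) - 1) = -1 := by field_simp; ring
  linarith

theorem stirlingError_nonneg (j : ℕ) : 0 ≤ stirlingError j := by
  induction j with
  | zero => simp [stirlingError]
  | succ j ih =>
    rw [stirlingError_succ]
    linarith [mul_log_succ_sub_log_le_one j]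

theorem stirlingError_succ_le (j : ℕ) : stirlingError (j + 1) ≤ 1 + Real.log (j + 1) := by
  induction j with
  | zero => simp [stirlingError]
  | succ j ih =>
    rw [stirlingError_succ]
    have h := one_le_succ_mul_log_succ_sub_log (Nat.succ_pos j)
    push_cast at h ⊢
    linarith

theorem stirlingError_le {j d : ℕ} (hj : j ≤ d) :
    stirlingError j ≤ 1 + Real.log d := by
  cases j with
  | zero =>
    have : 0 ≤ Real.log (d : ℝ) := Real.log_natCast_nonneg d
    simp only [stirlingError, Nat.factorial_zero, Nat.cast_one, Real.log_one, Nat.cast_zero]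
    linarith
  | succ j =>
    refine (stirlingError_succ_le j).trans ?_
    gcongr
    exact_mod_cast hj

theorem log_factorial_eq_rescaled {j d : ℕ} (hd : 0 < d) :
    Real.log (j.factorial : ℝ) =
      j * Real.log d + d * ((j / d : ℝ) * Real.log (j / d)) - j + stirlingError j := by
  have hd' : (d : ℝ) ≠ 0 := by exact_mod_cast hd.ne'
  rcases Nat.eq_zero_or_pos j with rfl | hj
  · simp [stirlingError]
  have hj' : (j : ℝ) ≠ 0 := by positivity
  rw [Real.log_div hj' hd', stirlingError]
  field_simp
  ring

theorem log_factorial_add_bounds {N : ℕ} (hN : 0 < N) (k : ℕ) :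
    k * Real.log N ≤ Real.log ((k + N).factorial : ℝ) - Real.log (N.factorial : ℝ) ∧
      Real.log ((k + N).factorial : ℝ) - Real.log (N.factorial : ℝ) ≤
        k * Real.log ((k + N : ℕ) : ℝ) := by
  constructor
  · have h : ((N ^ k * N.factorial : ℕ) : ℝ) ≤ ((k + N).factorial : ℕ) := by
      exact_mod_cast (Nat.mul_le_mul_right _ (Nat.pow_le_pow_left N.le_succ k)).trans
        (by simpa [mul_comm, add_comm] using Nat.factorial_mul_pow_le_factorial (m := N) (n := k))
    have h' := Real.log_le_log (by positivity) h
    push_cast at h'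
    rw [Real.log_mul (by positivity) (by positivity), Real.log_pow] at h'
    linarith
  · have h : (((k + N).factorial : ℕ) : ℝ) ≤ (N.factorial * (k + N) ^ k : ℕ) := by
      rw [add_comm k N, ← Nat.factorial_mul_ascFactorial]
      exact_mod_cast Nat.mul_le_mul_left _ (Nat.ascFactorial_le_pow_add N k)
    have h' := Real.log_le_log (by positivity) h
    push_cast at h'
    rw [Real.log_mul (by positivity) (by positivity), Real.log_pow] at h'
    push_cast
    linarith

/-- The logarithm of the normalization of the coefficients. -/
noncomputable def logNormalization (β : ℝ) (n d : ℕ) : ℝ :=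
  β * Real.log (n.factorial : ℝ) + (1 - β) * Real.log ((n - d).factorial : ℝ) -
    β * (d * Real.log d) + d

theorem log_rescaled_coeff (β : ℝ) {n d k : ℕ} (hd : 0 < d) (hdn : d < n) (hk : k ≤ d) :
    (1 / (d : ℝ)) *
        Real.log
          ((((n.choose (k + (n - d)) : ℝ)) ^ β *
              (((k + (n - d)).factorial : ℝ) / (k.factorial : ℝ)) *
              ((((n : ℝ) / (d : ℝ)) ^ (1 - β)) ^ (-(k : ℝ)))) /
            Real.exp (logNormalization β n d)) -
      (-(((k : ℝ) / (d : ℝ)) * Real.log ((k : ℝ) / (d : ℝ))) -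
        β * (1 - (k : ℝ) / (d : ℝ)) * Real.log (1 - (k : ℝ) / (d : ℝ)) +
        (1 - β) * ((k : ℝ) / (d : ℝ)) + β - 1) =
    (1 / (d : ℝ)) *
      ((1 - β) * (Real.log ((k + (n - d)).factorial : ℝ) - Real.log ((n - d).factorial : ℝ) -
          k * Real.log n) - stirlingError k - β * stirlingError (d - k)) := by
  have hd' : (0 : ℝ) < d := by exact_mod_cast hd
  have hn' : (0 : ℝ) < n := by exact_mod_cast hd.trans hdn
  have hm : k + (n - d) ≤ n := by omega
  have hc : (0 : ℝ) < n.choose (k + (n - d)) := by exact_mod_cast Nat.choose_pos hm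
  have hchoose : Real.log (n.choose (k + (n - d)) : ℝ) = Real.log (n.factorial : ℝ) -
      Real.log ((k + (n - d)).factorial : ℝ) - Real.log ((d - k).factorial : ℝ) := by
    have h := Nat.choose_mul_factorial_mul_factorial hm
    rw [show n - (k + (n - d)) = d - k by omega] at h
    rw [← h]
    push_cast
    rw [Real.log_mul (by positivity) (by positivity), Real.log_mul (by positivity) (by positivity)]
    ring
  rw [Real.log_div (by positivity) (by positivity), Real.log_exp,
    Real.log_mul (by positivity) (by positivity), Real.log_mul (by positivity) (by positivity),
    Real.log_rpow hc, Real.log_div (by positivity) (by positivity),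
    Real.log_rpow (by positivity), Real.log_rpow (by positivity),
    Real.log_div (by positivity) (by positivity), hchoose,
    log_factorial_eq_rescaled (j := k) hd, log_factorial_eq_rescaled (j := d - k) hd, Nat.cast_sub hk,
    show ((d : ℝ) - k) / d = 1 - k / d by field_simp, logNormalization]
  generalize Real.log ((k : ℝ) / d) = a
  generalize Real.log (1 - (k : ℝ) / d) = b
  field_simp
  ring

theorem abs_log_rescaled_coeff_le {β : ℝ} (hβ : 0 ≤ β) {n d k : ℕ} (hd : 0 < d) (hdn : d < n)
    (hk : k ≤ d) :
    |(1 / (d : ℝ)) *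
      ((1 - β) * (Real.log ((k + (n - d)).factorial : ℝ) - Real.log ((n - d).factorial : ℝ) -
          k * Real.log n) - stirlingError k - β * stirlingError (d - k))| ≤
      (1 + β) * (-Real.log (1 - (d : ℝ) / n) + (1 + Real.log d) / d) := by
  have hd' : (0 : ℝ) < d := by exact_mod_cast hd
  have hn' : (0 : ℝ) < n := by exact_mod_cast hd.trans hdn
  have hN : 0 < n - d := by omega
  have hN' : (0 : ℝ) < ((n - d : ℕ) : ℝ) := by exact_mod_cast hN
  have hkd : (k : ℝ) ≤ d := by exact_mod_cast hk
  obtain ⟨hlo, hhi⟩ := log_factorial_add_bounds hN k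
  set δ := Real.log ((k + (n - d)).factorial : ℝ) - Real.log ((n - d).factorial : ℝ) -
    k * Real.log n with hδ
  have hlog : -Real.log (1 - (d : ℝ) / n) = Real.log n - Real.log ((n - d : ℕ) : ℝ) := by
    rw [show 1 - (d : ℝ) / n = ((n - d : ℕ) : ℝ) / n by
      rw [Nat.cast_sub hdn.le]; field_simp, Real.log_div hN'.ne' hn'.ne']
    ring
  have hgap : Real.log ((n - d : ℕ) : ℝ) ≤ Real.log n := by
    apply Real.log_le_log hN'
    exact_mod_cast Nat.sub_le n d
  have hδ0 : δ ≤ 0 := by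
    have h : Real.log ((k + (n - d) : ℕ) : ℝ) ≤ Real.log n := by
      apply Real.log_le_log (by positivity)
      exact_mod_cast (by omega : k + (n - d) ≤ n)
    have := mul_le_mul_of_nonneg_left h (Nat.cast_nonneg (α := ℝ) k)
    linarith
  have hδ1 : |δ| ≤ d * (Real.log n - Real.log ((n - d : ℕ) : ℝ)) := by
    rw [abs_of_nonpos hδ0]
    have := mul_le_mul_of_nonneg_right hkd (sub_nonneg.2 hgap)
    linarith
  have hβ1 : |1 - β| ≤ 1 + β := abs_le.2 ⟨by linarith, by linarith⟩
  have hprod : |(1 - β) * δ| ≤ (1 + β) * (d * (Real.log n - Real.log ((n - d : ℕ) : ℝ))) := by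
    rw [abs_mul]
    exact mul_le_mul hβ1 hδ1 (abs_nonneg _) (by linarith)
  have hE1 := stirlingError_nonneg k
  have hE2 := stirlingError_le hk
  have hE3 := mul_nonneg hβ (stirlingError_nonneg (d - k))
  have hE4 := mul_le_mul_of_nonneg_left (stirlingError_le (Nat.sub_le d k)) hβ
  obtain ⟨hp1, hp2⟩ := abs_le.1 hprod
  have hL : 0 ≤ Real.log (d : ℝ) := Real.log_natCast_nonneg d
  rw [abs_mul, abs_of_pos (by positivity : 0 < 1 / (d : ℝ)), hlog, one_div_mul_eq_div,
    div_le_iff₀ hd']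
  have hrhs : (1 + β) * (Real.log n - Real.log ((n - d : ℕ) : ℝ) + (1 + Real.log d) / d) * d =
      (1 + β) * (d * (Real.log n - Real.log ((n - d : ℕ) : ℝ))) + (1 + β) * (1 + Real.log d) := by
    field_simp
  rw [hrhs, abs_le]
  have := mul_nonneg hβ hL
  constructor <;> linarith

theorem tendsto_coeff_error_bound (β : ℝ) {D : ℕ → ℕ}
    (hDtop : Filter.Tendsto D Filter.atTop Filter.atTop)
    (hDo : Filter.Tendsto (fun n => (D n : ℝ) / (n : ℝ)) Filter.atTop (nhds 0)) :
    Filter.Tendsto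
      (fun n => (1 + β) * (-Real.log (1 - (D n : ℝ) / n) + (1 + Real.log (D n)) / D n))
      Filter.atTop (nhds 0) := by
  have h1 : Filter.Tendsto (fun n => -Real.log (1 - (D n : ℝ) / n)) Filter.atTop (nhds 0) := by
    have h : Filter.Tendsto (fun n => 1 - (D n : ℝ) / n) Filter.atTop (nhds 1) := by
      simpa using hDo.const_sub 1
    simpa using (h.log one_ne_zero).neg
  have h2 : Filter.Tendsto (fun x : ℝ => (1 + Real.log x) / x) Filter.atTop (nhds 0) := by
    have ha := tendsto_inv_atTop_zero (𝕜 := ℝ)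
    have hb := Real.isLittleO_log_id_atTop.tendsto_div_nhds_zero
    simpa [add_div] using ha.add hb
  have h3 := h2.comp (tendsto_natCast_atTop_atTop.comp hDtop)
  simpa [Function.comp_def] using (h1.add h3).const_mul (1 + β)


/- STATEMENT 10: Let β ≥ 0 and D_n → ∞ with D_n/n → 0.  Set N_n = n − D_n and
R_n = (n/D_n)^{1−β}.  For the coefficients
T_{k,n} = binom(n, k+N_n)^β · ((k+N_n)!/k!) · R_n^{−k}, 0 ≤ k ≤ D_n, and
log P_β(x) = −x log x − β(1−x)log(1−x) + (1−β)x + β − 1 (with 0·log 0 = 0, which holds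
automatically since Real.log 0 = 0), there exist constants c_n > 0 with
lim_{n→∞} sup_{0≤k≤D_n} | (1/D_n)·log(T_{k,n}/c_n) − log P_β(k/D_n) | = 0. -/
theorem stmt10 (β : ℝ) (hβ : 0 ≤ β) (D : ℕ → ℕ)
    (hDpos : ∀ n, 0 < D n)
    (hDtop : Filter.Tendsto D Filter.atTop Filter.atTop)
    (hDo : Filter.Tendsto (fun n => (D n : ℝ) / (n : ℝ)) Filter.atTop (nhds 0)) :
    ∃ c : ℕ → ℝ, (∀ n, 0 < c n) ∧
      ∀ ε : ℝ, 0 < ε → ∃ N : ℕ, ∀ n ≥ N, ∀ k ≤ D n,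
        |(1 / (D n : ℝ)) *
            Real.log
              ((((n.choose (k + (n - D n)) : ℝ)) ^ β *
                  (((k + (n - D n)).factorial : ℝ) / (k.factorial : ℝ)) *
                  ((((n : ℝ) / (D n : ℝ)) ^ (1 - β)) ^ (-(k : ℝ)))) / c n) -
          (-(((k : ℝ) / (D n : ℝ)) * Real.log ((k : ℝ) / (D n : ℝ))) -
            β * (1 - (k : ℝ) / (D n : ℝ)) * Real.log (1 - (k : ℝ) / (D n : ℝ)) +
            (1 - β) * ((k : ℝ) / (D n : ℝ)) + β - 1)| < ε := by
  refine ⟨fun n => Real.exp (logNormalization β n (D n)), fun n => Real.exp_pos _, ?_⟩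
  intro ε hε
  refine Filter.eventually_atTop.1 ?_
  filter_upwards [(tendsto_coeff_error_bound β hDtop hDo).eventually_lt_const hε,
    hDo.eventually_lt_const one_pos, Filter.eventually_gt_atTop 0] with n hn hlt hn0 k hk
  have hdn : D n < n := by
    rw [div_lt_one (by exact_mod_cast hn0)] at hlt
    exact_mod_cast hlt
  rw [log_rescaled_coeff β (hDpos n) hdn hk]
  exact (abs_log_rescaled_coeff_le hβ (hDpos n) hdn hk).trans_lt hn
end

section
/- Let Q₀ : (0,1) → (0,∞) be the constant function Q₀ ≡ 1 (the radial quantile function of the uniform probability measure on the unit circle, the limiting root measure of the Kac polynomial Σ_{k=0}^n ξ_k z^k). Then for every t ∈ (0,1), the differentiation flow gives Q_t(x) = x(1−t)/(x(1−t)+t) for all x ∈ (0,1). Moreover, Q_t is exactly the quantile function of the CDF Φ_t : [0,∞) → [0,1] defined by Φ_t(r) = (t/(1−t))·r/(1−r) for 0 ≤ r < 1−t and Φ_t(r) = 1 for r ≥ 1−t, which is the limiting radial CDF (due to Feng–Yao) of the roots of the ⌈tn⌉-th derivative of the Kac polynomial. -/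
/- STATEMENT 17: If Q₀ ≡ 1 on (0,1) (the radial quantile function of the uniform measure
on the unit circle, the limiting root measure of the Kac polynomial), then for every
t ∈ (0,1) the differentiation flow gives Q_t(x) = x(1−t)/(x(1−t)+t) on (0,1).  Moreover,
Q_t is exactly the quantile function of the Feng–Yao CDF
Φ_t(r) = (t/(1−t))·r/(1−r) for 0 ≤ r < 1−t and Φ_t(r) = 1 for r ≥ 1−t. -/
theorem stmt17 (Q₀ : ℝ → ℝ) (hQ₀ : ∀ x ∈ Set.Ioo (0 : ℝ) 1, Q₀ x = 1)
    (t : ℝ) (ht : t ∈ Set.Ioo (0 : ℝ) 1) :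
    (∀ x ∈ Set.Ioo (0 : ℝ) 1,
      x * (1 - t) * Q₀ ((1 - t) * x + t) / (x * (1 - t) + t)
        = x * (1 - t) / (x * (1 - t) + t)) ∧
    (∀ x ∈ Set.Ioo (0 : ℝ) 1,
      sInf {r : ℝ | 0 ≤ r ∧
          x ≤ (if r < 1 - t then (t / (1 - t)) * (r / (1 - r)) else 1)}
        = x * (1 - t) / (x * (1 - t) + t)) := by
  obtain ⟨ht0, ht1⟩ := ht
  have hs : 0 < 1 - t := sub_pos.2 ht1
  refine ⟨fun x ⟨hx0, hx1⟩ => ?_, fun x ⟨hx0, hx1⟩ => ?_⟩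
  · rw [hQ₀ _ ⟨by positivity, by nlinarith⟩, mul_one]
  · have hD : 0 < x * (1 - t) + t := by positivity
    have hlt : x * (1 - t) / (x * (1 - t) + t) < 1 - t := by
      rw [div_lt_iff₀ hD]
      nlinarith [mul_pos hs (mul_pos ht0 (sub_pos.2 hx1))]
    refine IsLeast.csInf_eq ⟨⟨by positivity, ?_⟩, ?_⟩
    · rw [if_pos hlt]
      have hq : 1 - x * (1 - t) / (x * (1 - t) + t) = t / (x * (1 - t) + t) := by
        rw [eq_div_iff hD.ne', sub_mul, div_mul_cancel₀ _ hD.ne']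
        ring
      rw [hq, div_div_div_cancel_right₀ hD.ne', div_mul_div_cancel₀' ht0.ne',
        mul_div_cancel_right₀ _ hs.ne']
    · rintro r ⟨hr0, hr⟩
      split_ifs at hr with h
      · have hr1 : 0 < 1 - r := by linarith
        rw [div_mul_div_comm, le_div_iff₀ (mul_pos hs hr1)] at hr
        rw [div_le_iff₀ hD]
        linarith
      · exact hlt.le.trans (not_lt.1 h)
end

section
/- Define S : (−1,0) → ℝ by S(z) = 1/((1+z)(2+z)). Then S is a strictly decreasing bijection from (−1,0) onto (1/2, ∞), and for every r ∈ (0, √2) its inverse satisfies 1 + S^{⟨−1⟩}(r^{−2}) = (−1 + √(1+4r²))/2. Equivalently, setting F(r) := (−1 + √(1+4r²))/2, one has F(r) ∈ (0,1) and S(F(r) − 1) = r^{−2} for all r ∈ (0,√2), and F(√2) = 1. (By the Haagerup–Larsen formula, F is therefore the radial cumulative distribution function of the Brown measure of the commutator xy − yx of two free circular elements, whose associated S-transform is S_comm(z) = 1/((1+z)(2+z)).) -/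
theorem half_sqrt_sub_one_mem_Ioo {t : ℝ} (ht : t ∈ Set.Ioo (0 : ℝ) 2) :
    (-1 + Real.sqrt (1 + 4 * t)) / 2 ∈ Set.Ioo (0 : ℝ) 1 := by
  obtain ⟨h0, h2⟩ := ht
  have hlow : 1 < Real.sqrt (1 + 4 * t) := Real.lt_sqrt_of_sq_lt (by linarith)
  have hupp : Real.sqrt (1 + 4 * t) < 3 := (Real.sqrt_lt' (by norm_num)).2 (by linarith)
  constructor <;> linarith

theorem one_div_half_sqrt_sub_one {t : ℝ} (ht : 0 ≤ t) :
    1 / ((1 + ((-1 + Real.sqrt (1 + 4 * t)) / 2 - 1)) *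
      (2 + ((-1 + Real.sqrt (1 + 4 * t)) / 2 - 1))) = t⁻¹ := by
  have hs := Real.sq_sqrt (show 0 ≤ 1 + 4 * t by linarith)
  rw [one_div]
  congr 1
  linear_combination hs / 4

theorem strictAntiOn_one_div_one_add_mul_two_add :
    StrictAntiOn (fun z : ℝ => 1 / ((1 + z) * (2 + z))) (Set.Ioi (-1)) := by
  intro a (ha : -1 < a) b _ hab
  exact one_div_lt_one_div_of_lt (mul_pos (by linarith) (by linarith)) (by nlinarith)

/- STATEMENT 18: S(z) = 1/((1+z)(2+z)) is a strictly decreasing bijection from (−1,0)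
onto (1/2,∞), and its inverse satisfies 1 + S^{⟨−1⟩}(r^{−2}) = (−1+√(1+4r²))/2 for
r ∈ (0,√2): setting F(r) = (−1+√(1+4r²))/2, one has F(r) ∈ (0,1) and S(F(r)−1) = r^{−2}
for all r ∈ (0,√2), and F(√2) = 1.  (F is the radial CDF of the Brown measure of the
commutator of two free circular elements.) -/
theorem stmt18 :
    StrictAntiOn (fun z : ℝ => 1 / ((1 + z) * (2 + z))) (Set.Ioo (-1) 0) ∧
    Set.BijOn (fun z : ℝ => 1 / ((1 + z) * (2 + z))) (Set.Ioo (-1) 0)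
      (Set.Ioi (1 / 2)) ∧
    (∀ r ∈ Set.Ioo (0 : ℝ) (Real.sqrt 2),
      (-1 + Real.sqrt (1 + 4 * r ^ 2)) / 2 ∈ Set.Ioo (0 : ℝ) 1 ∧
      (fun z : ℝ => 1 / ((1 + z) * (2 + z))) ((-1 + Real.sqrt (1 + 4 * r ^ 2)) / 2 - 1)
        = (r ^ 2)⁻¹) ∧
    (-1 + Real.sqrt (1 + 4 * (Real.sqrt 2) ^ 2)) / 2 = 1 := by
  have hanti := strictAntiOn_one_div_one_add_mul_two_add.mono
    (Set.Ioo_subset_Ioi_self (a := (0 : ℝ)) (b := -1))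
  refine ⟨hanti, ⟨?_, hanti.injOn, ?_⟩, ?_, ?_⟩
  · rintro z ⟨h1, h0⟩
    have hpos : 0 < (1 + z) * (2 + z) := mul_pos (by linarith) (by linarith)
    exact one_div_lt_one_div_of_lt hpos (by nlinarith)
  · intro y (hy : 1 / 2 < y)
    have hy0 : 0 < y := by linarith
    have ht : y⁻¹ < 2 := inv_lt_of_inv_lt₀ (by norm_num) (by linarith)
    obtain ⟨h0, h1⟩ := half_sqrt_sub_one_mem_Ioo ⟨inv_pos.2 hy0, ht⟩
    exact ⟨(-1 + Real.sqrt (1 + 4 * y⁻¹)) / 2 - 1, ⟨by linarith, by linarith⟩,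
      (one_div_half_sqrt_sub_one (inv_pos.2 hy0).le).trans (inv_inv y)⟩
  · rintro r ⟨h0, h2⟩
    exact ⟨half_sqrt_sub_one_mem_Ioo ⟨by positivity, (Real.lt_sqrt h0.le).1 h2⟩,
      one_div_half_sqrt_sub_one (sq_nonneg r)⟩
  · rw [Real.sq_sqrt (by norm_num), show (1 + 4 * 2 : ℝ) = 3 ^ 2 by norm_num,
      Real.sqrt_sq (by norm_num)]
    norm_num
end
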